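/- Let q ≥ 1 be an integer and let (s_j)_{j=0}^∞ be a Stieltjes positive definite sequence of complex q×q matrices with Dyukarev–Stieltjes parameters [(𝔏_k)_{k=0}^∞, (𝔐_k)_{k=0}^∞] and associated matrix polynomials P_n, Q̂_n. Then for all k ∈ ℕ₀ and all m ∈ {0, …, k}: 𝔏_k = [P_m(0)]^{−*} · 𝔏_{k−m}^{(2m)} · [P_m(0)]^{−1} = Q̂_m(0) · 𝔐_{k−m}^{(2m+1)} · [Q̂_m(0)]^*, 𝔐_k = P_m(0) · 𝔐_{k−m}^{(2m)} · [P_m(0)]^*, and 𝔐_{k+1} = [Q̂_m(0)]^{−*} · 𝔏_{k−m}^{(2m+1)} · [Q̂_m(0)]^{−1}, where A^{−*} := (A^{−1})^*. -/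

import Mathlib

open Matrix
open scoped ComplexOrder

noncomputable section

/-- The space of complex `q × q` matrices. -/
abbrev Mq (q : ℕ) := Matrix (Fin q) (Fin q) ℂ

/-- The space of complex `2q × 2q` matrices, written in `q × q` blocks. -/
abbrev M2q (q : ℕ) := Matrix (Fin q ⊕ Fin q) (Fin q ⊕ Fin q) ℂ

/-- Block Hankel matrix `H_n = (s_{j+k})_{j,k=0}^n`. -/
def Hmat (q : ℕ) (s : ℕ → Mq q) (n : ℕ) :
    Matrix (Fin (n + 1) × Fin q) (Fin (n + 1) × Fin q) ℂ :=
  Matrix.of fun p r => s (p.1.1 + r.1.1) p.2 r.2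

/-- Block Hankel matrix `K_n = (s_{j+k+1})_{j,k=0}^n`. -/
def Kmat (q : ℕ) (s : ℕ → Mq q) (n : ℕ) :
    Matrix (Fin (n + 1) × Fin q) (Fin (n + 1) × Fin q) ℂ :=
  Matrix.of fun p r => s (p.1.1 + r.1.1 + 1) p.2 r.2

/-- A sequence of complex `q × q` matrices is Stieltjes positive definite if all the
block Hankel matrices `H_n` and `K_n` are positive definite (in particular Hermitian). -/
def IsStieltjesPD (q : ℕ) (s : ℕ → Mq q) : Prop :=
  ∀ n : ℕ, (Hmat q s n).PosDef ∧ (Kmat q s n).PosDef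

/-- Even Stieltjes parameters `𝔮_{2k}` (Schur complements `L_k`). -/
def qEven (q : ℕ) (s : ℕ → Mq q) : ℕ → Mq q
  | 0 => s 0
  | k + 1 =>
      s (2 * (k + 1)) -
        (Matrix.of fun (a : Fin q) (r : Fin (k + 1) × Fin q) => s (k + 1 + r.1.1) a r.2) *
          (Hmat q s k)⁻¹ *
          (Matrix.of fun (p : Fin (k + 1) × Fin q) (b : Fin q) => s (k + 1 + p.1.1) p.2 b)

/-- Odd Stieltjes parameters `𝔮_{2k+1}` (Schur complements `Λ_k`). -/
def qOdd (q : ℕ) (s : ℕ → Mq q) : ℕ → Mq q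
  | 0 => s 1
  | k + 1 =>
      s (2 * (k + 1) + 1) -
        (Matrix.of fun (a : Fin q) (r : Fin (k + 1) × Fin q) => s (k + 2 + r.1.1) a r.2) *
          (Kmat q s k)⁻¹ *
          (Matrix.of fun (p : Fin (k + 1) × Fin q) (b : Fin q) => s (k + 2 + p.1.1) p.2 b)

/-- Stieltjes parametrization `𝔮_j`. -/
def qpar (q : ℕ) (s : ℕ → Mq q) (j : ℕ) : Mq q :=
  if j % 2 = 0 then qEven q s (j / 2) else qOdd q s (j / 2)

/-- Reciprocal sequence `s^♯`. -/
def reciprocal (q : ℕ) (s : ℕ → Mq q) : ℕ → Mq q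
  | 0 => (s 0)⁻¹
  | j + 1 =>
      -(s 0)⁻¹ *
        ∑ l ∈ (Finset.range (j + 1)).attach, s (j + 1 - l.1) * reciprocal q s l.1
  decreasing_by exact Finset.mem_range.mp l.2

/-- First Kátětov transform `s^{(1)}_j = −s_0 s_{j+1}^♯ s_0`. -/
def katetov1 (q : ℕ) (s : ℕ → Mq q) : ℕ → Mq q :=
  fun j => -(s 0) * reciprocal q s (j + 1) * s 0

/-- `ℓ`-th Kátětov transform (the `ℓ`-fold iterate of the first Kátětov transform). -/
def katetov (q : ℕ) (ℓ : ℕ) (s : ℕ → Mq q) : ℕ → Mq q :=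
  (katetov1 q)^[ℓ] s

/-- `v_k = col(I_q, 0_{kq×q})`. -/
def vcol (q k : ℕ) : Matrix (Fin (k + 1) × Fin q) (Fin q) ℂ :=
  Matrix.of fun p b => if p.1.1 = 0 ∧ p.2 = b then 1 else 0

/-- `y_{0,k} = col(s_0, …, s_k)`. -/
def ycol (q : ℕ) (s : ℕ → Mq q) (k : ℕ) : Matrix (Fin (k + 1) × Fin q) (Fin q) ℂ :=
  Matrix.of fun p b => s p.1.1 p.2 b

/-- Dyukarev–Stieltjes parameters `𝔐_k`. -/
def DSM (q : ℕ) (s : ℕ → Mq q) : ℕ → Mq q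
  | 0 => (s 0)⁻¹
  | k + 1 =>
      (vcol q (k + 1))ᴴ * (Hmat q s (k + 1))⁻¹ * vcol q (k + 1) -
        (vcol q k)ᴴ * (Hmat q s k)⁻¹ * vcol q k

/-- Dyukarev–Stieltjes parameters `𝔏_k`. -/
def DSL (q : ℕ) (s : ℕ → Mq q) : ℕ → Mq q
  | 0 => s 0 * (s 1)⁻¹ * s 0
  | k + 1 =>
      (ycol q s (k + 1))ᴴ * (Kmat q s (k + 1))⁻¹ * ycol q s (k + 1) -
        (ycol q s k)ᴴ * (Kmat q s k)⁻¹ * ycol q s k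

/-- Ordered product `A_0 A_1 ⋯ A_n`. -/
def oprod {α : Type*} [Monoid α] (f : ℕ → α) (n : ℕ) : α :=
  ((List.range (n + 1)).map f).prod

/-- Block shift `T_n = (δ_{j,k+1} I_q)_{j,k=0}^n`. -/
def Tmat (q n : ℕ) : Matrix (Fin (n + 1) × Fin q) (Fin (n + 1) × Fin q) ℂ :=
  Matrix.of fun p r => if p.1.1 = r.1.1 + 1 ∧ p.2 = r.2 then 1 else 0

/-- `R_n(z) = (I_{(n+1)q} − z T_n)⁻¹`. -/
def Rmat (q n : ℕ) (z : ℂ) : Matrix (Fin (n + 1) × Fin q) (Fin (n + 1) × Fin q) ℂ :=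
  (1 - z • Tmat q n)⁻¹

/-- `u_0 = 0`, `u_n = col(0_{q×q}, −y_{0,n−1})`. -/
def ucol (q : ℕ) (s : ℕ → Mq q) (n : ℕ) : Matrix (Fin (n + 1) × Fin q) (Fin q) ℂ :=
  Matrix.of fun p b => if p.1.1 = 0 then 0 else -(s (p.1.1 - 1) p.2 b)

/-- `col(−H_n⁻¹ y_{n+1,2n+1}, I_q)` of size `(n+2)q × q`. -/
def colH (q : ℕ) (s : ℕ → Mq q) (n : ℕ) : Matrix (Fin (n + 2) × Fin q) (Fin q) ℂ :=
  Matrix.of fun p b =>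
    if h : p.1.1 < n + 1 then
      (-((Hmat q s n)⁻¹ *
          Matrix.of fun (r : Fin (n + 1) × Fin q) (c : Fin q) => s (n + 1 + r.1.1) r.2 c))
        (⟨p.1.1, h⟩, p.2) b
    else if p.2 = b then 1 else 0

/-- `col(−K_n⁻¹ y_{n+2,2n+2}, I_q)` of size `(n+2)q × q`. -/
def colK (q : ℕ) (s : ℕ → Mq q) (n : ℕ) : Matrix (Fin (n + 2) × Fin q) (Fin q) ℂ :=
  Matrix.of fun p b =>
    if h : p.1.1 < n + 1 then
      (-((Kmat q s n)⁻¹ *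
          Matrix.of fun (r : Fin (n + 1) × Fin q) (c : Fin q) => s (n + 2 + r.1.1) r.2 c))
        (⟨p.1.1, h⟩, p.2) b
    else if p.2 = b then 1 else 0

/-- `z_{0,n} = row(s_0, …, s_n)`. -/
def zrow (q : ℕ) (s : ℕ → Mq q) (n : ℕ) : Matrix (Fin q) (Fin (n + 1) × Fin q) ℂ :=
  Matrix.of fun a r => s r.1.1 a r.2

/-- Orthogonal matrix polynomials `P_n`. -/
def Ppoly (q : ℕ) (s : ℕ → Mq q) : ℕ → ℂ → Mq q
  | 0, _ => 1
  | n + 1, z => (vcol q (n + 1))ᴴ * (Rmat q (n + 1) (starRingEnd ℂ z))ᴴ * colH q s n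

/-- Second kind matrix polynomials `Q_n`. -/
def Qpoly (q : ℕ) (s : ℕ → Mq q) : ℕ → ℂ → Mq q
  | 0, _ => 0
  | n + 1, z => -((ucol q s (n + 1))ᴴ * (Rmat q (n + 1) (starRingEnd ℂ z))ᴴ * colH q s n)

/-- Matrix polynomials `P̂_n`. -/
def Phat (q : ℕ) (s : ℕ → Mq q) : ℕ → ℂ → Mq q
  | 0, _ => 1
  | n + 1, z => (vcol q (n + 1))ᴴ * (Rmat q (n + 1) (starRingEnd ℂ z))ᴴ * colK q s n

/-- Matrix polynomials `Q̂_n`. -/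
def Qhat (q : ℕ) (s : ℕ → Mq q) : ℕ → ℂ → Mq q
  | 0, _ => s 0
  | n + 1, z => zrow q s (n + 1) * (Rmat q (n + 1) (starRingEnd ℂ z))ᴴ * colK q s n

/-- `α_n(z)`. -/
def alphaP (q : ℕ) (s : ℕ → Mq q) (n : ℕ) (z : ℂ) : Mq q :=
  1 - z • ((ucol q s n)ᴴ * (Rmat q n (starRingEnd ℂ z))ᴴ * (Hmat q s n)⁻¹ * vcol q n)

/-- `γ_n(z)`. -/
def gammaP (q : ℕ) (s : ℕ → Mq q) (n : ℕ) (z : ℂ) : Mq q :=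
  -(z • ((vcol q n)ᴴ * (Rmat q n (starRingEnd ℂ z))ᴴ * (Hmat q s n)⁻¹ * vcol q n))

/-- `β_n(z)`. -/
def betaP (q : ℕ) (s : ℕ → Mq q) : ℕ → ℂ → Mq q
  | 0, _ => 0
  | n + 1, z => (ycol q s n)ᴴ * (Rmat q n (starRingEnd ℂ z))ᴴ * (Kmat q s n)⁻¹ * ycol q s n

/-- `δ_n(z)`. -/
def deltaP (q : ℕ) (s : ℕ → Mq q) : ℕ → ℂ → Mq q
  | 0, _ => 1
  | n + 1, z =>
      1 + z • ((vcol q n)ᴴ * (Rmat q n (starRingEnd ℂ z))ᴴ * (Kmat q s n)⁻¹ * ycol q s n)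

/-- The resolvent matrices `U_m(z)`. -/
def Umat (q : ℕ) (s : ℕ → Mq q) (m : ℕ) (z : ℂ) : M2q q :=
  if m % 2 = 0 then
    Matrix.fromBlocks (alphaP q s (m / 2) z) (betaP q s (m / 2) z)
      (gammaP q s (m / 2) z) (deltaP q s (m / 2) z)
  else
    Matrix.fromBlocks (alphaP q s (m / 2) z) (betaP q s (m / 2 + 1) z)
      (gammaP q s (m / 2) z) (deltaP q s (m / 2 + 1) z)

/-- `𝕄_k(z) = [[I, 0], [−z𝔐_k, I]]`. -/
def MM (q : ℕ) (s : ℕ → Mq q) (k : ℕ) (z : ℂ) : M2q q :=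
  Matrix.fromBlocks 1 0 (-(z • DSM q s k)) 1

/-- `𝕃_k = [[I, 𝔏_k], [0, I]]`. -/
def LL (q : ℕ) (s : ℕ → Mq q) (k : ℕ) : M2q q :=
  Matrix.fromBlocks 1 (DSL q s k) 0 1

/-- `𝒫_n = diag([P_n(0)]^{−*}, P_n(0))`. -/
def PPmat (q : ℕ) (s : ℕ → Mq q) (n : ℕ) : M2q q :=
  Matrix.fromBlocks (((Ppoly q s n 0)⁻¹)ᴴ) 0 0 (Ppoly q s n 0)

/-- `𝐐_n(z) = [[0, Q̂_n(0)], [−z[Q̂_n(0)]^{−*}, 0]]`. -/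
def QQgen (q : ℕ) (s : ℕ → Mq q) (n : ℕ) (z : ℂ) : M2q q :=
  Matrix.fromBlocks 0 (Qhat q s n 0) (-(z • ((Qhat q s n 0)⁻¹)ᴴ)) 0

/-- `𝐐_0^{(ℓ)}(z) = [[0, s_0^{(ℓ)}], [−z(s_0^{(ℓ)})⁻¹, 0]]`. -/
def QQ0 (q : ℕ) (s : ℕ → Mq q) (ℓ : ℕ) (z : ℂ) : M2q q :=
  Matrix.fromBlocks 0 (katetov q ℓ s 0) (-(z • (katetov q ℓ s 0)⁻¹)) 0

/-- `𝒬_m(z) = 𝐐_0^{(0)}(z) ⋯ 𝐐_0^{(m)}(z)`. -/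
def Qprod (q : ℕ) (s : ℕ → Mq q) (m : ℕ) (z : ℂ) : M2q q :=
  oprod (fun ℓ => QQ0 q s ℓ z) m

section algebraic
variable {R : Type*} [Ring R]

/-- Data of a sequence together with its shifted (negative) reciprocal. -/
structure RecData (s r : ℕ → R) (u : R) : Prop where
  su : s 0 * u = 1
  us : u * s 0 = 1
  f1 : ∀ j, ∑ b ∈ Finset.range (j + 1), r b * s (j - b) = u * s (j + 1)
  f2 : ∀ i, ∑ a ∈ Finset.range (i + 1), s (i - a) * r a = s (i + 1) * u

lemma RecData.X_left {s r : ℕ → R} {u : R} (h : RecData s r u) (i j : ℕ) :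
    ∑ a ∈ Finset.range (i + 2), ∑ b ∈ Finset.range (j + 1), s (i + 1 - a) * r (a + b) * s (j - b)
      = s (i + 1) * u * s (j + 1) +
        ∑ a ∈ Finset.range (i + 1), ∑ b ∈ Finset.range (j + 1),
          s (i - a) * r (a + b + 1) * s (j - b) := by
  rw [Finset.sum_range_succ', add_comm]
  congr 1
  · simp only [Nat.sub_zero, zero_add, mul_assoc]
    rw [← Finset.mul_sum, h.f1]
  · refine Finset.sum_congr rfl fun a _ => Finset.sum_congr rfl fun b _ => ?_
    rw [Nat.add_sub_add_right, Nat.add_right_comm]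

lemma RecData.X_right {s r : ℕ → R} {u : R} (h : RecData s r u) (i j : ℕ) :
    ∑ a ∈ Finset.range (i + 1), ∑ b ∈ Finset.range (j + 2), s (i - a) * r (a + b) * s (j + 1 - b)
      = s (i + 1) * u * s (j + 1) +
        ∑ a ∈ Finset.range (i + 1), ∑ b ∈ Finset.range (j + 1),
          s (i - a) * r (a + b + 1) * s (j - b) := by
  rw [← h.f2, Finset.sum_mul, ← Finset.sum_add_distrib]
  refine Finset.sum_congr rfl fun a _ => ?_
  rw [Finset.sum_range_succ', add_comm]
  congr 1
  refine Finset.sum_congr rfl fun b _ => ?_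
  rw [Nat.add_sub_add_right, Nat.add_assoc]

lemma RecData.X_eq {s r : ℕ → R} {u : R} (h : RecData s r u) (i j : ℕ) :
    ∑ a ∈ Finset.range (i + 1), ∑ b ∈ Finset.range (j + 1), s (i - a) * r (a + b) * s (j - b)
      = s (i + j + 1) := by
  induction i generalizing j with
  | zero =>
    simp only [zero_add, Finset.range_one, Finset.sum_singleton, Nat.sub_zero, mul_assoc]
    rw [← Finset.mul_sum, h.f1, ← mul_assoc, h.su, one_mul]
  | succ i ih =>
    rw [h.X_left, ← h.X_right, ih]
    congr 1
    omega

lemma RecData.Y_eq {s r : ℕ → R} {u : R} (h : RecData s r u) (i j : ℕ) :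
    s (i + 1) * u * s (j + 1) +
        ∑ a ∈ Finset.range (i + 1), ∑ b ∈ Finset.range (j + 1),
          s (i - a) * r (a + b + 1) * s (j - b) = s (i + j + 2) := by
  rw [← h.X_left, h.X_eq]
  congr 1
  omega

end algebraic

section recip
variable {q : ℕ} {s : ℕ → Mq q}

lemma reciprocal_zero : reciprocal q s 0 = (s 0)⁻¹ := by
  rw [reciprocal]

lemma reciprocal_succ (j : ℕ) : reciprocal q s (j + 1) =
    -(s 0)⁻¹ * ∑ l ∈ Finset.range (j + 1), s (j + 1 - l) * reciprocal q s l := by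
  rw [reciprocal, Finset.sum_attach (Finset.range (j+1)) (fun l => s (j + 1 - l) * reciprocal q s l)]

lemma sum_recip (h0 : IsUnit (s 0).det) (j : ℕ) :
    ∑ l ∈ Finset.range (j + 1), s (j - l) * reciprocal q s l = if j = 0 then 1 else 0 := by
  cases j with
  | zero => simp [reciprocal_zero, Matrix.mul_nonsing_inv _ h0]
  | succ j =>
    rw [Finset.sum_range_succ, reciprocal_succ]
    simp only [Nat.sub_self, neg_mul, mul_neg]
    rw [Matrix.mul_nonsing_inv_cancel_left _ _ h0]
    simp

lemma recip_series (h0 : IsUnit (s 0).det) :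
    (PowerSeries.mk s) * (PowerSeries.mk (reciprocal q s)) = 1 := by
  ext1 j
  rw [PowerSeries.coeff_mul, ← Finset.Nat.sum_antidiagonal_swap,
    Finset.Nat.sum_antidiagonal_eq_sum_range_succ_mk]
  simp only [Prod.swap, PowerSeries.coeff_mk, PowerSeries.coeff_one]
  exact sum_recip h0 j

lemma recip_series' (h0 : IsUnit (s 0).det) :
    (PowerSeries.mk (reciprocal q s)) * (PowerSeries.mk s) = 1 := by
  obtain ⟨u, hu⟩ := (Matrix.isUnit_iff_isUnit_det _).2 h0
  have h1 := PowerSeries.invOfUnit_mul (PowerSeries.mk s) u (by simp [hu])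
  rw [← left_inv_eq_right_inv h1 (recip_series h0)]
  exact h1

lemma sum_recip' (h0 : IsUnit (s 0).det) (j : ℕ) :
    ∑ l ∈ Finset.range (j + 1), reciprocal q s l * s (j - l) = if j = 0 then 1 else 0 := by
  have h := congrArg (PowerSeries.coeff j) (recip_series' h0)
  rw [PowerSeries.coeff_mul, Finset.Nat.sum_antidiagonal_eq_sum_range_succ_mk] at h
  simpa only [PowerSeries.coeff_mk, PowerSeries.coeff_one] using h

lemma recData (h0 : IsUnit (s 0).det) :
    RecData s (fun j => (s 0)⁻¹ * katetov1 q s j * (s 0)⁻¹) (s 0)⁻¹ := by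
  have hr : ∀ j, (s 0)⁻¹ * katetov1 q s j * (s 0)⁻¹ = - reciprocal q s (j + 1) := by
    intro j
    simp only [katetov1, neg_mul, mul_neg]
    rw [Matrix.mul_assoc (s 0), Matrix.nonsing_inv_mul_cancel_left _ _ h0,
      Matrix.mul_nonsing_inv_cancel_right _ _ h0]
  refine ⟨Matrix.mul_nonsing_inv _ h0, Matrix.nonsing_inv_mul _ h0, fun j => ?_, fun i => ?_⟩
  · have h := sum_recip' h0 (j + 1)
    rw [Finset.sum_range_succ', reciprocal_zero] at h
    simp only [hr, neg_mul, Finset.sum_neg_distrib]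
    simp only [Nat.add_sub_add_right, Nat.sub_zero, Nat.add_eq_zero_iff, one_ne_zero, and_false,
      if_false] at h
    exact (eq_neg_of_add_eq_zero_right h).symm
  · have h := sum_recip h0 (i + 1)
    rw [Finset.sum_range_succ', reciprocal_zero] at h
    simp only [hr, mul_neg, Finset.sum_neg_distrib]
    simp only [Nat.add_sub_add_right, Nat.sub_zero, Nat.add_eq_zero_iff, one_ne_zero, and_false,
      if_false] at h
    exact (eq_neg_of_add_eq_zero_right h).symm

end recip

section blocks
set_option linter.unusedSectionVars false
variable {q : ℕ} {α β γ : Type*} [Fintype α] [Fintype β] [Fintype γ]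

/-- Block matrix with given blocks. -/
def blk (f : α → β → Mq q) : Matrix (α × Fin q) (β × Fin q) ℂ :=
  Matrix.of fun p r => f p.1 r.1 p.2 r.2

/-- Block column with given blocks. -/
def bcol (f : α → Mq q) : Matrix (α × Fin q) (Fin q) ℂ :=
  Matrix.of fun p b => f p.1 p.2 b

lemma blk_mul_blk (f : α → β → Mq q) (g : β → γ → Mq q) :
    blk f * blk g = blk fun i k => ∑ j, f i j * g j k := by
  ext ⟨i, a⟩ ⟨k, b⟩
  simp [blk, Matrix.mul_apply, Fintype.sum_prod_type, Matrix.sum_apply]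

lemma blk_mul_bcol (f : α → β → Mq q) (g : β → Mq q) :
    blk f * bcol g = bcol fun i => ∑ j, f i j * g j := by
  ext ⟨i, a⟩ b
  simp [blk, bcol, Matrix.mul_apply, Fintype.sum_prod_type, Matrix.sum_apply]

lemma bcolH_mul_bcol (f g : α → Mq q) :
    (bcol f)ᴴ * bcol g = ∑ j, (f j)ᴴ * g j := by
  ext a b
  simp [bcol, Matrix.mul_apply, Fintype.sum_prod_type, Matrix.sum_apply]

lemma bcol_mul (f : α → Mq q) (c : Mq q) : bcol f * c = bcol fun i => f i * c := by
  ext ⟨i, a⟩ b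
  simp [bcol, Matrix.mul_apply]

lemma blkH (f : α → β → Mq q) : (blk f)ᴴ = blk fun i j => (f j i)ᴴ := by
  ext ⟨i, a⟩ ⟨k, b⟩
  simp [blk]

lemma exists_bcol (M : Matrix (α × Fin q) (Fin q) ℂ) : ∃ f, M = bcol f :=
  ⟨fun i => Matrix.of fun a b => M (i, a) b, by ext ⟨i, a⟩ b; rfl⟩

lemma bcol_inj {f g : α → Mq q} (h : bcol f = bcol g) : f = g := by
  funext i
  ext a b
  exact congrFun (congrFun h (i, a)) b

end blocks

section basic
variable {q : ℕ} {s : ℕ → Mq q}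

lemma sum_tri {M : Type*} [AddCommMonoid M] {n i : ℕ} (hi : i ≤ n) (f : ℕ → M) :
    ∑ a : Fin (n + 1), (if a.1 ≤ i then f a.1 else 0) = ∑ a ∈ Finset.range (i + 1), f a := by
  rw [Fin.sum_univ_eq_sum_range (fun a => if a ≤ i then f a else 0), ← Finset.sum_filter]
  congr 1
  ext a
  simp only [Finset.mem_filter, Finset.mem_range]
  omega

lemma vcol_eq (n : ℕ) : vcol q n = bcol fun i : Fin (n + 1) => if i.1 = 0 then (1 : Mq q) else 0 := by
  ext ⟨⟨i, hi⟩, a⟩ b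
  by_cases h : i = 0
  · simp only [vcol, bcol, h, Matrix.of_apply, true_and, if_true, Matrix.one_apply]
  · simp only [vcol, bcol, h, Matrix.of_apply, false_and, if_false, Matrix.zero_apply]

lemma ycol_eq (n : ℕ) : ycol q s n = bcol fun i : Fin (n + 1) => s i.1 := rfl

lemma Hmat_eq (n : ℕ) : Hmat q s n = blk fun i j : Fin (n + 1) => s (i.1 + j.1) := rfl

lemma Kmat_eq (n : ℕ) : Kmat q s n = blk fun i j : Fin (n + 1) => s (i.1 + j.1 + 1) := rfl

lemma Kmat_shift (n : ℕ) : Kmat q s n = Hmat q (fun j => s (j + 1)) n := rfl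

lemma herm (hs : IsStieltjesPD q s) (j : ℕ) : (s j)ᴴ = s j := by
  have h := (hs j).1.1
  ext a b
  have := congrFun (congrFun h (⟨0, by omega⟩, a)) (⟨j, by omega⟩, b)
  simpa [Hmat] using this

lemma blk_unique {c : Mq q} {P : Matrix (Fin 1 × Fin q) (Fin 1 × Fin q) ℂ}
    (hP : P = blk fun _ _ => c) (h : IsUnit P) : IsUnit c := by
  obtain ⟨N, hN⟩ := h.exists_right_inv
  refine IsUnit.of_mul_eq_one (Matrix.of fun a b => N (0, a) (0, b)) ?_
  ext a b
  have := congrFun (congrFun hN (0, a)) (0, b)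
  simpa [hP, blk, Matrix.mul_apply, Fintype.sum_prod_type, Matrix.one_apply] using this

lemma unit0 (hs : IsStieltjesPD q s) : IsUnit (s 0).det := by
  rw [← Matrix.isUnit_iff_isUnit_det]
  refine blk_unique (P := Hmat q s 0) ?_ (hs 0).1.isUnit
  ext ⟨i, a⟩ ⟨j, b⟩
  simp [Hmat, blk]

lemma unit1 (hs : IsStieltjesPD q s) : IsUnit (s 1).det := by
  rw [← Matrix.isUnit_iff_isUnit_det]
  refine blk_unique (P := Kmat q s 0) ?_ (hs 0).2.isUnit
  ext ⟨i, a⟩ ⟨j, b⟩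
  simp [Kmat, blk]

lemma inv_herm (hs : IsStieltjesPD q s) : ((s 0)⁻¹)ᴴ = (s 0)⁻¹ := by
  rw [Matrix.conjTranspose_nonsing_inv, herm hs]

/-- Unit lower triangular Toeplitz matrix. -/
def Amat (q : ℕ) (s : ℕ → Mq q) (n : ℕ) :
    Matrix (Fin (n + 1) × Fin q) (Fin (n + 1) × Fin q) ℂ :=
  blk fun i j => if j.1 ≤ i.1 then s (i.1 - j.1) * (s 0)⁻¹ else 0

/-- `diag(s_0, K_n(t))`. -/
def Gmat (q : ℕ) (s : ℕ → Mq q) (n : ℕ) :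
    Matrix (Fin (n + 2) × Fin q) (Fin (n + 2) × Fin q) ℂ :=
  blk fun i j => if i.1 = 0 then (if j.1 = 0 then s 0 else 0) else
    if j.1 = 0 then 0 else katetov1 q s (i.1 + j.1 - 1)

lemma AmatH (hs : IsStieltjesPD q s) (n : ℕ) : (Amat q s n)ᴴ =
    blk fun i j => if i.1 ≤ j.1 then (s 0)⁻¹ * s (j.1 - i.1) else 0 := by
  rw [Amat, blkH]
  congr 1
  funext i j
  split_ifs
  · rw [Matrix.conjTranspose_mul, inv_herm hs, herm hs]
  · simp

lemma Amat_conj (hs : IsStieltjesPD q s) (n : ℕ) (g : ℕ → ℕ → Mq q) :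
    Amat q s n * (blk fun i j => g i.1 j.1) * (Amat q s n)ᴴ =
      blk fun i j => ∑ a ∈ Finset.range (i.1 + 1), ∑ b ∈ Finset.range (j.1 + 1),
        s (i.1 - a) * ((s 0)⁻¹ * g a b * (s 0)⁻¹) * s (j.1 - b) := by
  rw [AmatH hs, Amat, blk_mul_blk, blk_mul_blk]
  congr 1
  funext i j
  have hi : i.1 ≤ n := by omega
  have hj : j.1 ≤ n := by omega
  have e1 : ∀ b : Fin (n + 1), (∑ a : Fin (n + 1),
      (if a.1 ≤ i.1 then s (i.1 - a.1) * (s 0)⁻¹ else 0) * g a.1 b.1) =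
      ∑ a ∈ Finset.range (i.1 + 1), s (i.1 - a) * (s 0)⁻¹ * g a b.1 := by
    intro b
    rw [← sum_tri hi]
    simp only [ite_mul, zero_mul]
  simp only [e1]
  rw [Finset.sum_comm, ← sum_tri hj]
  refine Finset.sum_congr rfl fun b _ => ?_
  split_ifs
  · rw [Finset.sum_mul]
    refine Finset.sum_congr rfl fun a _ => ?_
    simp only [Matrix.mul_assoc]
  · simp

lemma fact1 (hs : IsStieltjesPD q s) (n : ℕ) :
    Kmat q s n = Amat q s n * Hmat q (katetov1 q s) n * (Amat q s n)ᴴ := by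
  rw [Hmat_eq, Amat_conj hs n (fun i j => katetov1 q s (i + j)), Kmat_eq]
  congr 1
  funext i j
  exact ((recData (unit0 hs)).X_eq i.1 j.1).symm

lemma fact2 (hs : IsStieltjesPD q s) (n : ℕ) :
    Hmat q s (n + 1) = Amat q s (n + 1) * Gmat q s n * (Amat q s (n + 1))ᴴ := by
  rw [Gmat, Amat_conj hs (n + 1) (fun i j => if i = 0 then (if j = 0 then s 0 else 0) else
    if j = 0 then 0 else katetov1 q s (i + j - 1)), Hmat_eq]
  congr 1
  funext i j
  have R := recData (unit0 hs)
  rw [Finset.sum_range_succ']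
  have e0 : ∀ a, ∑ b ∈ Finset.range (j.1 + 1), s (i.1 - (a + 1)) *
      ((s 0)⁻¹ * (if a + 1 = 0 then (if b = 0 then s 0 else 0) else
    if b = 0 then 0 else katetov1 q s (a + 1 + b - 1)) * (s 0)⁻¹) * s (j.1 - b) =
      ∑ b ∈ Finset.range j.1, s (i.1 - (a + 1)) *
      ((s 0)⁻¹ * katetov1 q s (a + b + 1) * (s 0)⁻¹) * s (j.1 - (b + 1)) := by
    intro a
    rw [Finset.sum_range_succ']
    simp only [Nat.add_eq_zero_iff, one_ne_zero, and_false, if_false, if_true, mul_zero, zero_mul,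
      add_zero]
    refine Finset.sum_congr rfl fun b _ => ?_
    rw [show a + 1 + (b + 1) - 1 = a + b + 1 by omega]
  have e1 : ∑ b ∈ Finset.range (j.1 + 1), s (i.1 - 0) *
      ((s 0)⁻¹ * (if 0 = 0 then (if b = 0 then s 0 else 0) else
    if b = 0 then 0 else katetov1 q s (0 + b - 1)) * (s 0)⁻¹) * s (j.1 - b) =
      s i.1 * (s 0)⁻¹ * s j.1 := by
    rw [Finset.sum_range_succ']
    simp [R.us]
  rw [e1]
  simp only [e0]
  rcases i with ⟨i, hi⟩
  rcases j with ⟨j, hj⟩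
  simp only
  cases i with
  | zero => simp [R.su]
  | succ i =>
    cases j with
    | zero => simp [Matrix.mul_assoc, R.us]
    | succ j =>
      simp only [Nat.add_sub_add_right]
      rw [add_comm (Finset.sum _ _), R.Y_eq]
      congr 1
      omega

lemma Amat_unit (hs : IsStieltjesPD q s) (n : ℕ) : IsUnit (Amat q s n) := by
  have h := (hs n).2.isUnit
  rw [fact1 hs, Matrix.isUnit_iff_isUnit_det, Matrix.det_mul, Matrix.det_mul, mul_assoc] at h
  rw [Matrix.isUnit_iff_isUnit_det]
  exact isUnit_of_mul_isUnit_left h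

lemma Gmat_pd (hs : IsStieltjesPD q s) (n : ℕ) : (Gmat q s n).PosDef := by
  have h := (hs (n + 1)).1
  rw [fact2 hs] at h
  exact (Matrix.IsUnit.posDef_star_right_conjugate_iff (Amat_unit hs (n + 1))).1 h

lemma kat_pd (hs : IsStieltjesPD q s) : IsStieltjesPD q (katetov1 q s) := by
  intro n
  constructor
  · have h := (hs n).2
    rw [fact1 hs] at h
    exact (Matrix.IsUnit.posDef_star_right_conjugate_iff (Amat_unit hs n)).1 h
  · have h := (Gmat_pd hs n).submatrix (e := fun p : Fin (n + 1) × Fin q => (p.1.succ, p.2))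
      (by
        rintro ⟨i, a⟩ ⟨j, b⟩ h
        simpa using h)
    convert h using 1
    ext ⟨i, a⟩ ⟨j, b⟩
    simp [Kmat, Gmat, blk, show i.1 + 1 + (j.1 + 1) - 1 = i.1 + j.1 + 1 by omega]

lemma congr_conj_inv {ι : Type*} [Fintype ι] [DecidableEq ι] {A G : Matrix ι ι ℂ} (hA : IsUnit A) :
    Aᴴ * (A * G * Aᴴ)⁻¹ * A = G⁻¹ := by
  have h1 := (Matrix.isUnit_iff_isUnit_det _).1 hA
  have h2 : IsUnit (Aᴴ).det := by rw [Matrix.det_conjTranspose]; exact h1.star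
  rw [Matrix.mul_inv_rev, Matrix.mul_inv_rev, Matrix.mul_nonsing_inv_cancel_left _ _ h2,
    Matrix.nonsing_inv_mul_cancel_right _ _ h1]

end basic

section steps
variable {q : ℕ} {s : ℕ → Mq q}

/-- `v_k^* H_k⁻¹ v_k`. -/
def muS (q : ℕ) (s : ℕ → Mq q) (k : ℕ) : Mq q :=
  (vcol q k)ᴴ * (Hmat q s k)⁻¹ * vcol q k

/-- `y_{0,k}^* K_k⁻¹ y_{0,k}`. -/
def laS (q : ℕ) (s : ℕ → Mq q) (k : ℕ) : Mq q :=
  (ycol q s k)ᴴ * (Kmat q s k)⁻¹ * ycol q s k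

lemma inv_mul_of_eq {ι κ : Type*} [Fintype ι] [DecidableEq ι] {M : Matrix ι ι ℂ}
    {X Y : Matrix ι κ ℂ} (hM : IsUnit M) (h : M * X = Y) : M⁻¹ * Y = X := by
  rw [← h, Matrix.nonsing_inv_mul_cancel_left _ _ ((Matrix.isUnit_iff_isUnit_det _).1 hM)]

lemma mul_of_inv_eq {ι κ : Type*} [Fintype ι] [DecidableEq ι] {M : Matrix ι ι ℂ}
    {X Y : Matrix ι κ ℂ} (hM : IsUnit M) (h : M⁻¹ * Y = X) : M * X = Y := by
  rw [← h, Matrix.mul_nonsing_inv_cancel_left _ _ ((Matrix.isUnit_iff_isUnit_det _).1 hM)]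

lemma mu_zero (hs : IsStieltjesPD q s) : muS q s 0 = (s 0)⁻¹ := by
  have h : (Hmat q s 0)⁻¹ * vcol q 0 = bcol fun _ => (s 0)⁻¹ := by
    apply inv_mul_of_eq (hs 0).1.isUnit
    rw [Hmat_eq, vcol_eq, blk_mul_bcol]
    congr 1
    funext i
    simp [Matrix.mul_nonsing_inv _ (unit0 hs)]
  rw [muS, Matrix.mul_assoc, h, vcol_eq, bcolH_mul_bcol]
  simp

lemma la_zero (hs : IsStieltjesPD q s) : laS q s 0 = s 0 * (s 1)⁻¹ * s 0 := by
  have h : (Kmat q s 0)⁻¹ * ycol q s 0 = bcol fun _ => (s 1)⁻¹ * s 0 := by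
    apply inv_mul_of_eq (hs 0).2.isUnit
    rw [Kmat_eq, ycol_eq, blk_mul_bcol]
    congr 1
    funext i
    simp [Matrix.mul_nonsing_inv_cancel_left _ _ (unit1 hs)]
  rw [laS, Matrix.mul_assoc, h, ycol_eq, bcolH_mul_bcol]
  simp [herm hs, Matrix.mul_assoc]

lemma la_step (hs : IsStieltjesPD q s) (k : ℕ) :
    laS q s k = s 0 * muS q (katetov1 q s) k * s 0 := by
  have h : ycol q s k = Amat q s k * (vcol q k * s 0) := by
    rw [vcol_eq, bcol_mul, Amat, blk_mul_bcol, ycol_eq]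
    congr 1
    funext i
    rw [Finset.sum_eq_single 0]
    · simp [Matrix.mul_assoc, Matrix.nonsing_inv_mul _ (unit0 hs)]
    · intro b _ hb
      have : b.1 ≠ 0 := fun h => hb (Fin.ext h)
      simp [hb]
    · simp
  rw [laS, h, fact1 hs, Matrix.conjTranspose_mul, Matrix.conjTranspose_mul, herm hs, muS,
    ← congr_conj_inv (G := Hmat q (katetov1 q s) k) (Amat_unit hs k)]
  simp only [Matrix.mul_assoc]

/-- The blocks of `A⁻¹ v`. -/
def xfun (q : ℕ) (s : ℕ → Mq q) (n : ℕ) (i : Fin (n + 2)) : Mq q :=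
  Fin.cases 1 (fun j : Fin (n + 1) => -(katetov1 q s j.1 * (s 0)⁻¹)) i

lemma Amat_x (hs : IsStieltjesPD q s) (n : ℕ) :
    Amat q s (n + 1) * bcol (xfun q s n) = vcol q (n + 1) := by
  have R := recData (unit0 hs)
  rw [vcol_eq, Amat, blk_mul_bcol]
  congr 1
  funext i
  rw [Fin.sum_univ_succ]
  refine Fin.cases ?_ (fun i => ?_) i
  · simp [xfun, R.su]
  · have e := sum_tri (n := n) (i := i.1) (by omega)
      (fun a => s (i.1 - a) * ((s 0)⁻¹ * katetov1 q s a * (s 0)⁻¹))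
    rw [R.f2] at e
    simp only [xfun, Fin.cases_zero, Fin.cases_succ, Fin.val_zero, Fin.val_succ, Nat.zero_le,
      if_true, Nat.sub_zero, mul_one, Nat.add_le_add_iff_right, Nat.add_sub_add_right,
      Nat.add_eq_zero_iff, one_ne_zero, and_false, if_false]
    rw [← e, ← Finset.sum_add_distrib]
    refine Finset.sum_eq_zero fun a _ => ?_
    split_ifs
    · simp [Matrix.mul_assoc]
    · simp

lemma mu_step (hs : IsStieltjesPD q s) (k : ℕ) :
    muS q s (k + 1) = (s 0)⁻¹ + (s 0)⁻¹ * laS q (katetov1 q s) k * (s 0)⁻¹ := by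
  have R := recData (unit0 hs)
  have ht := kat_pd hs
  obtain ⟨f, hf⟩ := exists_bcol ((Kmat q (katetov1 q s) k)⁻¹ * ycol q (katetov1 q s) k)
  have hf' := mul_of_inv_eq (ht k).2.isUnit hf
  rw [Kmat_eq, ycol_eq, blk_mul_bcol] at hf'
  have hf2 := bcol_inj hf'
  have hG : (Gmat q s k)⁻¹ * bcol (xfun q s k) =
      bcol (fun i : Fin (k + 2) => Fin.cases ((s 0)⁻¹)
        (fun j : Fin (k + 1) => -(f j * (s 0)⁻¹)) i) := by
    apply inv_mul_of_eq (Gmat_pd hs k).isUnit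
    rw [Gmat, blk_mul_bcol]
    congr 1
    funext i
    rw [Fin.sum_univ_succ]
    refine Fin.cases ?_ (fun i => ?_) i
    · simp [xfun, R.su]
    · have := congrFun hf2 i
      simp only [xfun, Fin.cases_zero, Fin.cases_succ, Fin.val_zero, Fin.val_succ,
        if_true, Nat.add_eq_zero_iff, one_ne_zero, and_false, if_false, zero_mul, zero_add]
      rw [← this, Finset.sum_mul, ← Finset.sum_neg_distrib]
      refine Finset.sum_congr rfl fun j _ => ?_
      rw [show i.1 + 1 + (j.1 + 1) - 1 = i.1 + j.1 + 1 by omega]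
      simp [Matrix.mul_assoc]
  have e : muS q s (k + 1) = (bcol (xfun q s k))ᴴ * ((Gmat q s k)⁻¹ * bcol (xfun q s k)) := by
    rw [muS, ← Amat_x hs, fact2 hs, Matrix.conjTranspose_mul,
      ← congr_conj_inv (G := Gmat q s k) (Amat_unit hs (k + 1))]
    simp only [Matrix.mul_assoc]
  rw [e, hG, bcolH_mul_bcol, Fin.sum_univ_succ, laS, Matrix.mul_assoc (ycol q _ k)ᴴ, hf, ycol_eq,
    bcolH_mul_bcol, Finset.mul_sum, Finset.sum_mul]
  simp only [xfun, Fin.cases_zero, Fin.cases_succ]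
  simp [Matrix.mul_assoc, inv_herm hs, Matrix.conjTranspose_mul, herm ht]

lemma DSL_step (hs : IsStieltjesPD q s) (k : ℕ) :
    DSL q s k = s 0 * DSM q (katetov1 q s) k * s 0 := by
  have ht := kat_pd hs
  cases k with
  | zero =>
    have := la_step hs 0
    rw [la_zero hs, mu_zero ht] at this
    exact this
  | succ k =>
    have h1 := la_step hs (k + 1)
    have h2 := la_step hs k
    simp only [laS, muS] at h1 h2
    rw [DSL, DSM, h1, h2, mul_sub, sub_mul]

lemma DSM_step (hs : IsStieltjesPD q s) (k : ℕ) :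
    DSM q s (k + 1) = (s 0)⁻¹ * DSL q (katetov1 q s) k * (s 0)⁻¹ := by
  have ht := kat_pd hs
  cases k with
  | zero =>
    have h1 := mu_step hs 0
    have h2 := mu_zero hs
    rw [la_zero ht] at h1
    simp only [muS] at h1 h2
    rw [DSM, DSL, h1, h2, add_sub_cancel_left]
  | succ k =>
    have h1 := mu_step hs (k + 1)
    have h2 := mu_step hs k
    simp only [laS, muS] at h1 h2
    rw [DSM, DSL, h1, h2, mul_sub, sub_mul, add_sub_add_left_eq_sub]

end steps

section polys
variable {q : ℕ} {s : ℕ → Mq q}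

lemma Rmat_zero (n : ℕ) : (Rmat q n (starRingEnd ℂ 0))ᴴ = 1 := by
  simp [Rmat]

lemma colH_form (n : ℕ) (hH : IsUnit (Hmat q s n)) :
    ∃ f : Fin (n + 1) → Mq q,
      (∀ g : Fin (n + 1) → Mq q, g = f ↔
        ∀ i : Fin (n + 1), ∑ k, s (i.1 + k.1) * g k = s (n + 1 + i.1)) ∧
      colH q s n = bcol fun i => Fin.lastCases 1 (fun j => -f j) i := by
  obtain ⟨f, hf⟩ := exists_bcol ((Hmat q s n)⁻¹ *
    bcol (fun r : Fin (n + 1) => s (n + 1 + r.1)))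
  refine ⟨f, fun g => ⟨?_, fun h => ?_⟩, ?_⟩
  · rintro rfl
    have := mul_of_inv_eq hH hf
    rw [Hmat_eq, blk_mul_bcol] at this
    exact congrFun (bcol_inj this)
  · apply bcol_inj
    rw [← hf]
    symm
    apply inv_mul_of_eq hH
    rw [Hmat_eq, blk_mul_bcol]
    congr 1
    funext i
    exact h i
  · ext ⟨i, a⟩ b
    refine Fin.lastCases ?_ (fun j => ?_) i
    · simp [colH, bcol, Matrix.one_apply]
    · have : (Hmat q s n)⁻¹ * (Matrix.of fun (r : Fin (n + 1) × Fin q) (c : Fin q) =>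
          s (n + 1 + r.1.1) r.2 c) = bcol f := hf
      simp only [colH, bcol, Matrix.of_apply, Fin.lastCases_castSucc, Fin.val_castSucc, j.2,
        dif_pos, this, Matrix.neg_apply, Fin.eta]

/-- Characterisation of the columns `colH`. -/
def IsCol (q : ℕ) (s : ℕ → Mq q) (n : ℕ) (c : Fin (n + 2) → Mq q) : Prop :=
  c (Fin.last (n + 1)) = 1 ∧ ∀ i : ℕ, i ≤ n → ∑ k, s (i + k.1) * c k = 0

lemma colH_spec (n : ℕ) (hH : IsUnit (Hmat q s n)) :
    ∃ c, colH q s n = bcol c ∧ IsCol q s n c := by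
  obtain ⟨f, hf, h⟩ := colH_form n hH
  refine ⟨_, h, by simp, fun i hi => ?_⟩
  have := (hf f).1 rfl ⟨i, by omega⟩
  rw [Fin.sum_univ_castSucc]
  simp only [Fin.lastCases_castSucc, Fin.lastCases_last, Fin.val_castSucc, Fin.val_last, mul_neg,
    mul_one, Finset.sum_neg_distrib]
  simp only at this
  rw [this, add_comm i]
  simp

lemma colH_uniq (n : ℕ) (hH : IsUnit (Hmat q s n)) (c : Fin (n + 2) → Mq q)
    (hc : IsCol q s n c) : colH q s n = bcol c := by
  obtain ⟨f, hf, h⟩ := colH_form n hH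
  rw [h]
  congr 1
  have : (fun k : Fin (n + 1) => - c k.castSucc) = f := by
    rw [hf]
    intro i
    have := hc.2 i.1 (by omega)
    rw [Fin.sum_univ_castSucc, hc.1] at this
    simp only [Fin.val_castSucc, Fin.val_last, mul_one] at this
    simp only [mul_neg, Finset.sum_neg_distrib]
    rw [add_comm (n + 1)]
    exact (eq_neg_of_add_eq_zero_right this).symm
  funext i
  refine Fin.lastCases ?_ (fun j => ?_) i
  · simp [hc.1]
  · simp [← this]

lemma colK_eq (n : ℕ) : colK q s n = colH q (fun j => s (j + 1)) n := by
  ext ⟨i, a⟩ b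
  simp only [colK, colH, Kmat_shift, show ∀ r, n + 2 + r = n + 1 + r + 1 by intro r; omega]

lemma P_zero_eq (n : ℕ) (c : Fin (n + 2) → Mq q) (h : colH q s n = bcol c) :
    Ppoly q s (n + 1) 0 = c 0 := by
  rw [Ppoly, Rmat_zero, Matrix.mul_one, h, vcol_eq, bcolH_mul_bcol, Fin.sum_univ_succ]
  simp

lemma Qhat_zero_eq (n : ℕ) (c : Fin (n + 2) → Mq q) (h : colK q s n = bcol c) :
    Qhat q s (n + 1) 0 = ∑ k, s k.1 * c k := by
  rw [Qhat, Rmat_zero, Matrix.mul_one, h]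
  ext a b
  simp [zrow, bcol, Matrix.mul_apply, Fintype.sum_prod_type, Matrix.sum_apply]

/-- Forward substitution. -/
lemma forward (hs : IsStieltjesPD q s) (n m : ℕ) (g : Fin (n + 1) → Mq q)
    (e : Fin (n + 1) → Mq q) (h : Amat q s n * bcol g = bcol e)
    (he : ∀ i : Fin (n + 1), i.1 < m → e i = 0) : ∀ i : Fin (n + 1), i.1 < m → g i = 0 := by
  rw [Amat, blk_mul_bcol] at h
  have h := bcol_inj h
  have key : ∀ k (hk : k < n + 1), k < m → g ⟨k, hk⟩ = 0 := by
    intro k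
    induction k using Nat.strong_induction_on with
    | _ k ih =>
      intro hk hkm
      have h1 := congrFun h ⟨k, hk⟩
      rw [he _ hkm, Finset.sum_eq_single ⟨k, hk⟩] at h1
      · simpa [Matrix.mul_nonsing_inv _ (unit0 hs)] using h1
      · intro b _ hb
        have hb' : b.1 ≠ k := fun h => hb (Fin.ext h)
        by_cases hbk : b.1 ≤ k
        · have : g b = 0 := ih b.1 (by omega) b.2 (by omega)
          simp [this]
        · simp [hbk]
      · simp
  exact fun i hi => key i.1 i.2 hi

/-- Blocks of `A^* c`. -/
def upf (q : ℕ) (s : ℕ → Mq q) (n : ℕ) (c : Fin (n + 1) → Mq q) (i : Fin (n + 1)) : Mq q :=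
  ∑ j : Fin (n + 1), (if i.1 ≤ j.1 then (s 0)⁻¹ * s (j.1 - i.1) else 0) * c j

lemma AmatH_mul (hs : IsStieltjesPD q s) (n : ℕ) (c : Fin (n + 1) → Mq q) :
    (Amat q s n)ᴴ * bcol c = bcol (upf q s n c) := by
  rw [AmatH hs, blk_mul_bcol]
  rfl

lemma upf_last (hs : IsStieltjesPD q s) (n : ℕ) (c : Fin (n + 1) → Mq q) :
    upf q s n c (Fin.last n) = c (Fin.last n) := by
  rw [upf, Finset.sum_eq_single (Fin.last n)]
  · simp [Matrix.nonsing_inv_mul _ (unit0 hs)]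
  · intro b _ hb
    have hb' : b.1 ≠ n := fun h => hb (Fin.ext h)
    have : ¬ n ≤ b.1 := by omega
    simp [this]
  · simp

lemma upf_zero (n : ℕ) (c : Fin (n + 1) → Mq q) :
    upf q s n c 0 = (s 0)⁻¹ * ∑ j, s j.1 * c j := by
  simp [upf, Finset.mul_sum, Matrix.mul_assoc]

lemma Qhat_step (hs : IsStieltjesPD q s) (m : ℕ) :
    Qhat q s m 0 = s 0 * Ppoly q (katetov1 q s) m 0 := by
  cases m with
  | zero => simp [Qhat, Ppoly]
  | succ n =>
    obtain ⟨d, hd, hd1, hd2⟩ := colH_spec (q := q) (s := fun j => s (j + 1)) n (hs n).2.isUnit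
    rw [← colK_eq] at hd
    have hc : colH q (katetov1 q s) n = bcol (upf q s (n + 1) d) := by
      refine colH_uniq n (kat_pd hs n).1.isUnit _ ⟨by rw [upf_last hs, hd1], fun i hi => ?_⟩
      have h1 : Amat q s (n + 1) * bcol (fun i : Fin (n + 2) => ∑ k : Fin (n + 2),
          katetov1 q s (i.1 + k.1) * upf q s (n + 1) d k) =
          bcol (fun i : Fin (n + 2) => ∑ k : Fin (n + 2), s (i.1 + k.1 + 1) * d k) := by
        rw [← blk_mul_bcol, ← Hmat_eq, ← AmatH_mul hs, ← blk_mul_bcol, ← Kmat_eq, fact1 hs]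
        simp only [Matrix.mul_assoc]
      exact forward hs (n + 1) (n + 1) _ _ h1 (fun i hi => hd2 i.1 (by omega))
        ⟨i, by omega⟩ (by simp only; omega)
    rw [Qhat_zero_eq n d hd, P_zero_eq n _ hc, upf_zero,
      Matrix.mul_nonsing_inv_cancel_left _ _ (unit0 hs)]

lemma P_step (hs : IsStieltjesPD q s) (m : ℕ) :
    Ppoly q s (m + 1) 0 = -((s 0)⁻¹ * Qhat q (katetov1 q s) m 0) := by
  have R := recData (unit0 hs)
  have ht := kat_pd hs
  obtain ⟨c, hc, hc1, hc2⟩ := colH_spec (q := q) (s := s) m (hs m).1.isUnit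
  have hw0 : upf q s (m + 1) c 0 = 0 := by
    rw [upf_zero]
    have := hc2 0 (by omega)
    simp only [zero_add] at this
    rw [this, mul_zero]
  have h0 : c 0 = -((s 0)⁻¹ * ∑ j : Fin (m + 1),
      katetov1 q s j.1 * upf q s (m + 1) c j.succ) := by
    have e : (vcol q (m + 1))ᴴ * bcol c = c 0 := by
      rw [vcol_eq, bcolH_mul_bcol, Fin.sum_univ_succ]
      simp
    rw [← e, ← Amat_x hs, Matrix.conjTranspose_mul, Matrix.mul_assoc, AmatH_mul hs,
      bcolH_mul_bcol, Fin.sum_univ_succ, hw0]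
    simp only [xfun, Fin.cases_succ]
    simp [Matrix.conjTranspose_mul, inv_herm hs, herm ht, Finset.mul_sum, Matrix.mul_assoc]
  rw [P_zero_eq m c hc, h0]
  congr 2
  cases m with
  | zero =>
    have := upf_last hs 1 c
    rw [hc1] at this
    rw [Qhat, Fin.sum_univ_succ, Fin.sum_univ_zero, add_zero]
    exact (congrArg (katetov1 q s 0 * ·) this).trans (mul_one _)
  | succ n =>
    refine (Qhat_zero_eq n (fun j => upf q s (n + 2) c j.succ) ?_).symm
    rw [colK_eq]
    refine colH_uniq (s := fun j => katetov1 q s (j + 1)) n (kat_pd hs n).2.isUnit _ ⟨?_, fun i hi => ?_⟩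
    · exact (upf_last hs (n + 2) c).trans hc1
    · have h1 : Amat q s (n + 2) * bcol (fun i : Fin (n + 3) => ∑ k : Fin (n + 3),
          (if i.1 = 0 then (if k.1 = 0 then s 0 else 0) else
            if k.1 = 0 then 0 else katetov1 q s (i.1 + k.1 - 1)) * upf q s (n + 2) c k) =
          bcol (fun i : Fin (n + 3) => ∑ k : Fin (n + 3), s (i.1 + k.1) * c k) := by
        rw [← blk_mul_bcol, ← AmatH_mul hs, ← blk_mul_bcol, ← Hmat_eq, fact2 hs, Gmat]
        simp only [Matrix.mul_assoc]
      have h2 := forward hs (n + 2) (n + 2) _ _ h1 (fun i hi => hc2 i.1 (by omega))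
        ⟨i + 1, by omega⟩ (by simp only; omega)
      rw [Fin.sum_univ_succ] at h2
      simp only [Fin.val_zero, Fin.val_succ, if_true, Nat.add_eq_zero_iff, one_ne_zero, and_false,
        if_false, zero_mul, zero_add] at h2
      rw [← h2]
      refine Finset.sum_congr rfl fun j _ => ?_
      rw [show i + 1 + (j.1 + 1) - 1 = i + j.1 + 1 by omega]

end polys

lemma katetov_succ' (q l : ℕ) (s : ℕ → Mq q) :
    katetov q (l + 1) s = katetov q l (katetov1 q s) := rfl

lemma main_aux (q m : ℕ) : ∀ s : ℕ → Mq q, IsStieltjesPD q s → ∀ k, m ≤ k →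
    (DSL q s k =
        ((Ppoly q s m 0)⁻¹)ᴴ * DSL q (katetov q (2 * m) s) (k - m) * (Ppoly q s m 0)⁻¹) ∧
      (DSM q s k =
        Ppoly q s m 0 * DSM q (katetov q (2 * m) s) (k - m) * (Ppoly q s m 0)ᴴ) := by
  induction m with
  | zero =>
    intro s hs k _
    simp [Ppoly, katetov]
  | succ m ih =>
    intro s hs k hk
    obtain ⟨k, rfl⟩ : ∃ k', k = k' + 1 := ⟨k - 1, by omega⟩
    have ht := kat_pd hs
    obtain ⟨i1, i2⟩ := ih _ (kat_pd ht) k (by omega)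
    have hneg : ∀ A : Mq q, (-A)⁻¹ = -A⁻¹ := by
      intro A
      by_cases hA : IsUnit A.det
      · apply Matrix.inv_eq_right_inv
        rw [neg_mul_neg, Matrix.mul_nonsing_inv _ hA]
      · have hA' : ¬ IsUnit (-A).det := by
          rw [← Matrix.isUnit_iff_isUnit_det] at hA ⊢
          simpa using hA
        rw [Matrix.nonsing_inv_apply_not_isUnit _ hA, Matrix.nonsing_inv_apply_not_isUnit _ hA',
          neg_zero]
    have hP : Ppoly q s (m + 1) 0 = -((s 0)⁻¹ * (katetov1 q s 0 *
        Ppoly q (katetov1 q (katetov1 q s)) m 0)) := by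
      rw [P_step hs, Qhat_step ht]
    rw [show 2 * (m + 1) = 2 * m + 1 + 1 by ring, katetov_succ', katetov_succ', hP, hneg,
      Nat.add_sub_add_right]
    constructor
    · rw [DSL_step hs, DSM_step ht, i1]
      simp only [Matrix.mul_inv_rev, Matrix.conjTranspose_mul, Matrix.conjTranspose_neg,
        Matrix.nonsing_inv_nonsing_inv _ (unit0 hs), herm hs, inv_herm ht, Matrix.mul_assoc,
        neg_mul, mul_neg, neg_neg]
    · rw [DSM_step hs, DSL_step ht, i2]
      simp only [Matrix.conjTranspose_mul, Matrix.conjTranspose_neg,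
        inv_herm hs, herm ht, Matrix.mul_assoc, neg_mul, mul_neg, neg_neg]

/-- Dyukarev–Stieltjes parameters expressed through those of the Kátětov transforms and the
values `P_m(0)`, `Q̂_m(0)`. -/
theorem stmt7 (q : ℕ) (hq : 1 ≤ q) (s : ℕ → Mq q) (hs : IsStieltjesPD q s) (k m : ℕ) (hmk : m ≤ k) :
    DSL q s k =
        ((Ppoly q s m 0)⁻¹)ᴴ * DSL q (katetov q (2 * m) s) (k - m) * (Ppoly q s m 0)⁻¹ ∧
      DSL q s k =
        Qhat q s m 0 * DSM q (katetov q (2 * m + 1) s) (k - m) * (Qhat q s m 0)ᴴ ∧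
      DSM q s k =
        Ppoly q s m 0 * DSM q (katetov q (2 * m) s) (k - m) * (Ppoly q s m 0)ᴴ ∧
      DSM q s (k + 1) =
        ((Qhat q s m 0)⁻¹)ᴴ * DSL q (katetov q (2 * m + 1) s) (k - m) * (Qhat q s m 0)⁻¹ := by
  have ht := kat_pd hs
  obtain ⟨h1, h3⟩ := main_aux q m s hs k hmk
  obtain ⟨h4, h2⟩ := main_aux q m _ ht k hmk
  rw [katetov_succ', Qhat_step hs]
  refine ⟨h1, ?_, h3, ?_⟩
  · rw [DSL_step hs, h2]
    simp only [Matrix.conjTranspose_mul, herm hs, Matrix.mul_assoc]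
  · rw [DSM_step hs, h4]
    simp only [Matrix.mul_inv_rev, Matrix.conjTranspose_mul, inv_herm hs, Matrix.mul_assoc]

end
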